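/- Suppose f is convex on (0, ∞), and suppose n ≥ 1. Fix a stock price s_{n−1} > 0, a bond price b_{n−1} = b_0 (1+r)^{n−1} with b_0 > 0, and a final jump ξ with d ≤ ξ ≤ u; set s_n = s_{n−1} ξ and b_n = b_{n−1}(1+r). Then the terminal liquidation value of the hedging portfolio covers the claim: γ_{n−1}(u,d) · s_n + β_{n−1}(u,d) · b_n ≥ f(s_n), where γ_{n−1}(u,d) = (g_n(u,d, s_{n−1} u) − g_n(u,d, s_{n−1} d))/(s_{n−1}(u − d)) and β_{n−1}(u,d) = (u · g_n(u,d, s_{n−1} d) − d · g_n(u,d, s_{n−1} u))/((1+r) · b_{n−1} · (u − d)), and where g_n(u,d,s) = f(s). -/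

import Mathlib

/-- The risk-neutral probability `p(u,d) = ((1+r) - d)/(u - d)`. -/
noncomputable def priceP (r u d : ℝ) : ℝ := ((1 + r) - d) / (u - d)

/-- The rational price
`g_k(u,d,s) = (1+r)^{-(n-k)} ∑_{j=0}^{n-k} C(n-k,j) p^j (1-p)^{n-k-j} f(s u^j d^{n-k-j})`. -/
noncomputable def ratPrice (r : ℝ) (n : ℕ) (f : ℝ → ℝ) (u d : ℝ) (k : ℕ) (s : ℝ) : ℝ :=
  ((1 + r) ^ (n - k))⁻¹ *
    ∑ j ∈ Finset.range (n - k + 1),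
      (Nat.choose (n - k) j : ℝ) * priceP r u d ^ j * (1 - priceP r u d) ^ (n - k - j) *
        f (s * u ^ j * d ^ (n - k - j))

/-- The terminal liquidation value of the hedging portfolio covers the claim:
`γ_{n-1} s_n + β_{n-1} b_n ≥ f(s_n)`, where `g_n(u,d,s) = f(s)`. -/
theorem terminal_liquidation_covers_claim
    (r : ℝ) (hr : 0 ≤ r) (n : ℕ) (hn : 1 ≤ n) (u d : ℝ)
    (hd : 0 < d) (hdr : d < 1 + r) (hru : 1 + r < u) (f : ℝ → ℝ)
    (hf : ConvexOn ℝ (Set.Ioi (0 : ℝ)) f)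
    (sPrev : ℝ) (hs : 0 < sPrev) (b0 : ℝ) (hb0 : 0 < b0)
    (bPrev : ℝ) (hb : bPrev = b0 * (1 + r) ^ (n - 1))
    (ξ : ℝ) (hξd : d ≤ ξ) (hξu : ξ ≤ u)
    (sn bn : ℝ) (hsn : sn = sPrev * ξ) (hbn : bn = bPrev * (1 + r))
    (hgn : ∀ s : ℝ, ratPrice r n f u d n s = f s) :
    f sn ≤
      ((ratPrice r n f u d n (sPrev * u) - ratPrice r n f u d n (sPrev * d)) /
          (sPrev * (u - d))) * sn +
        ((u * ratPrice r n f u d n (sPrev * d) - d * ratPrice r n f u d n (sPrev * u)) /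
          ((1 + r) * bPrev * (u - d))) * bn := by
  have hud : 0 < u - d := by linarith
  have hr1 : 0 < 1 + r := by linarith
  have hbp : 0 < bPrev := by rw [hb]; positivity
  have hu : 0 < u := by linarith
  rw [hgn, hgn]
  have key := hf.2 (Set.mem_Ioi.mpr (mul_pos hs hu)) (Set.mem_Ioi.mpr (mul_pos hs hd))
    (div_nonneg (sub_nonneg.mpr hξd) hud.le) (div_nonneg (sub_nonneg.mpr hξu) hud.le)
    (by field_simp; ring)
  simp only [smul_eq_mul] at key
  have e : (ξ - d) / (u - d) * (sPrev * u) + (u - ξ) / (u - d) * (sPrev * d) = sn := by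
    rw [hsn]; field_simp; ring
  rw [e] at key
  refine key.trans (le_of_eq ?_)
  generalize f (sPrev * u) = A
  generalize f (sPrev * d) = B
  rw [hsn, hbn]
  field_simp
  ring
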